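/- There exist constants C>0 and h_0>0, depending only on k, α, β, γ, b-a and the quasi-uniformity constant c, such that whenever h ≤ h_0, u is 2k-times continuously differentiable with u(a)=u(b)=0, f := -αu''+βu'+γu, and ū_h is a Gauss collocation solution, then at every mesh node x_i, i=0,...,N: |(u-ū_h)(x_i)| ≤ C h^{2(k-1)} ‖u‖_{2k,∞} and |(u-ū_h)'(x_i)| ≤ C h^{2(k-1)} ‖u‖_{2k,∞}. -/

import Mathlib

open Set Finset intervalIntegral

/-- The Legendre polynomial of degree `n` (Rodrigues formula), as a real function. -/
noncomputable def legendre (n : ℕ) : ℝ → ℝ :=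
  fun s => (1 / ((2 : ℝ) ^ n * n.factorial)) * iteratedDeriv n (fun t : ℝ => (t ^ 2 - 1) ^ n) s

/-- The affine map sending `[-1,1]` onto `[p,q]`. -/
noncomputable def affMap (p q s : ℝ) : ℝ := (p + q) / 2 + s * (q - p) / 2

/-- `x 0 = a < x 1 < ... < x N = b` is a partition of `[a,b]`. -/
def IsMesh (a b : ℝ) (N : ℕ) (x : ℕ → ℝ) : Prop :=
  1 ≤ N ∧ x 0 = a ∧ x N = b ∧ ∀ i < N, x i < x (i + 1)

/-- `h` is the maximal element length `h = max_i (x i - x (i-1))`. -/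
def IsMeshSize (N : ℕ) (x : ℕ → ℝ) (h : ℝ) : Prop :=
  (∀ i ∈ Finset.Icc 1 N, x i - x (i - 1) ≤ h) ∧ ∃ i ∈ Finset.Icc 1 N, x i - x (i - 1) = h

/-- Quasi-uniformity with constant `c`: `h ≤ c · h_i` for all elements. -/
def IsQuasiUniform (N : ℕ) (x : ℕ → ℝ) (h c : ℝ) : Prop :=
  ∀ i ∈ Finset.Icc 1 N, h ≤ c * (x i - x (i - 1))

/-- `P i` are the element polynomials (degree ≤ k) of a member of `V_h^0`:
a C¹ piecewise polynomial vanishing at both ends of `[a,b]`. -/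
def IsVh0 (k N : ℕ) (x : ℕ → ℝ) (P : ℕ → Polynomial ℝ) : Prop :=
  (∀ i ∈ Finset.Icc 1 N, (P i).natDegree ≤ k) ∧
  (∀ i ∈ Finset.Icc 1 (N - 1), (P i).eval (x i) = (P (i + 1)).eval (x i)) ∧
  (∀ i ∈ Finset.Icc 1 (N - 1),
      (Polynomial.derivative (P i)).eval (x i) = (Polynomial.derivative (P (i + 1))).eval (x i)) ∧
  (P 1).eval (x 0) = 0 ∧ (P N).eval (x N) = 0

/-- `P i` are the element polynomials of a Petrov–Galerkin solution `u_h ∈ V_h^0`: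
`∑_i ∫_{τ_i} (-α u_h'' + β u_h' + γ u_h) v_h = ∫_a^b f v_h` for all `v_h ∈ W_h`. -/
def IsPGSol (k N : ℕ) (x : ℕ → ℝ) (α β γ : ℝ) (f : ℝ → ℝ) (P : ℕ → Polynomial ℝ) : Prop :=
  IsVh0 k N x P ∧
  ∀ Q : ℕ → Polynomial ℝ, (∀ i ∈ Finset.Icc 1 N, (Q i).natDegree ≤ k - 2) →
    (∑ i ∈ Finset.Icc 1 N, ∫ t in (x (i - 1))..(x i),
        (-α * ((Polynomial.derivative (Polynomial.derivative (P i))).eval t)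
            + β * ((Polynomial.derivative (P i)).eval t) + γ * (P i).eval t) * (Q i).eval t)
      = ∑ i ∈ Finset.Icc 1 N, ∫ t in (x (i - 1))..(x i), f t * (Q i).eval t

/-- `P i` are the element polynomials of a Gauss collocation solution `ū_h ∈ V_h^0`:
`(-α ū_h'' + β ū_h' + γ ū_h)(g) = f(g)` at every Gauss point `g` of every element. -/
def IsGaussSol (k N : ℕ) (x : ℕ → ℝ) (α β γ : ℝ) (f : ℝ → ℝ) (P : ℕ → Polynomial ℝ) : Prop :=
  IsVh0 k N x P ∧
  ∀ i ∈ Finset.Icc 1 N, ∀ s ∈ Set.Ioo (-1 : ℝ) 1, legendre (k - 1) s = 0 →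
    -α * ((Polynomial.derivative (Polynomial.derivative (P i))).eval (affMap (x (i - 1)) (x i) s))
        + β * ((Polynomial.derivative (P i)).eval (affMap (x (i - 1)) (x i) s))
        + γ * (P i).eval (affMap (x (i - 1)) (x i) s)
      = f (affMap (x (i - 1)) (x i) s)

/-- `p` is the elementwise truncated Jacobi projection of `u` on the element `[xl, xr]`:
the polynomial of degree ≤ k matching `u` and `u'` at both endpoints with
`(u - p)'' ⊥ P_{k-2}` in `L²(xl, xr)`. -/
def IsElemProj (k : ℕ) (u : ℝ → ℝ) (xl xr : ℝ) (p : Polynomial ℝ) : Prop :=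
  p.natDegree ≤ k ∧ p.eval xl = u xl ∧ p.eval xr = u xr ∧
  (Polynomial.derivative p).eval xl = deriv u xl ∧
  (Polynomial.derivative p).eval xr = deriv u xr ∧
  ∀ q : Polynomial ℝ, q.natDegree ≤ k - 2 →
    (∫ t in xl..xr,
        (iteratedDeriv 2 u t - (Polynomial.derivative (Polynomial.derivative p)).eval t)
          * q.eval t) = 0

/-- Rolle's theorem for `n + 1` zeros. -/
lemma exists_finset_deriv_eq_zero {f : ℝ → ℝ} (hf : Continuous f) {p q : ℝ} {n : ℕ}
    {s : Finset ℝ} (hs : ∀ x ∈ s, x ∈ Set.Icc p q) (hcard : s.card = n + 1)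
    (h0 : ∀ x ∈ s, f x = 0) :
    ∃ s' : Finset ℝ, s'.card = n ∧ ∀ x ∈ s', x ∈ Set.Ioo p q ∧ deriv f x = 0 := by
  classical
  set σ := s.orderEmbOfFin hcard with hσ
  have hmem : ∀ i, σ i ∈ s := fun i => s.orderEmbOfFin_mem hcard i
  have key : ∀ i : Fin n, ∃ ξ ∈ Set.Ioo (σ i.castSucc) (σ i.succ), deriv f ξ = 0 := fun i =>
    exists_deriv_eq_zero (σ.strictMono Fin.castSucc_lt_succ) hf.continuousOn
      (by rw [h0 _ (hmem _), h0 _ (hmem _)])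
  choose ξ hξ hd using key
  have hmono : StrictMono ξ := by
    intro i j hij
    have h1 : σ i.succ ≤ σ j.castSucc := σ.monotone (by
      rw [Fin.le_def]; simpa using hij)
    exact (hξ i).2.trans_le (h1.trans (hξ j).1.le)
  refine ⟨Finset.univ.image ξ, ?_, ?_⟩
  · rw [Finset.card_image_of_injective _ hmono.injective]; simp
  · intro x hx
    obtain ⟨i, -, rfl⟩ := Finset.mem_image.1 hx
    exact ⟨⟨(hs _ (hmem _)).1.trans_lt (hξ i).1, (hξ i).2.trans_le (hs _ (hmem _)).2⟩, hd i⟩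

/-- Mean value inequality on a closed interval for real functions. -/
lemma abs_sub_le_of_abs_deriv_le {f : ℝ → ℝ} (hf : Differentiable ℝ f) {p q S : ℝ}
    (hS : ∀ t ∈ Set.Icc p q, |deriv f t| ≤ S) {t ξ : ℝ} (ht : t ∈ Set.Icc p q)
    (hξ : ξ ∈ Set.Icc p q) : |f t - f ξ| ≤ (q - p) * S := by
  have h1 := (convex_Icc p q).norm_image_sub_le_of_norm_deriv_le (f := f) (C := S)
    (fun x _ => hf x) (fun x hx => by simpa using hS x hx) hξ ht
  simp only [Real.norm_eq_abs] at h1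
  have hS0 : 0 ≤ S := (abs_nonneg _).trans (hS t ht)
  have h2 : |t - ξ| ≤ q - p := by
    rw [abs_le]; constructor <;> linarith [ht.1, ht.2, hξ.1, hξ.2]
  nlinarith

lemma contDiff_deriv_of_succ {f : ℝ → ℝ} {n : ℕ} (hf : ContDiff ℝ (n + 1 : ℕ) f) :
    ContDiff ℝ n (deriv f) := by
  have : ContDiff ℝ ((n : WithTop ℕ∞) + 1) f := by exact_mod_cast hf
  exact (contDiff_succ_iff_deriv.1 this).2.2

/-- A function with `n` zeros in `[p, q]` is bounded by `(q - p) ^ n` times its `n`-th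
derivative. -/
lemma abs_le_pow_mul_of_zeros {p q S : ℝ} (n : ℕ) :
    ∀ {f : ℝ → ℝ}, ContDiff ℝ n f → ∀ {s : Finset ℝ}, s.card = n →
      (∀ x ∈ s, x ∈ Set.Icc p q) → (∀ x ∈ s, f x = 0) →
      (∀ t ∈ Set.Icc p q, |iteratedDeriv n f t| ≤ S) →
      ∀ t ∈ Set.Icc p q, |f t| ≤ (q - p) ^ n * S := by
  induction n with
  | zero => intro f _ s _ _ _ hS t ht; simpa using hS t ht
  | succ n ih =>
    intro f hf s hcard hs h0 hS t ht
    obtain ⟨s', hc', hs'⟩ := exists_finset_deriv_eq_zero hf.continuous hs hcard h0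
    have hf' : ContDiff ℝ n (deriv f) := contDiff_deriv_of_succ hf
    have hb := ih hf' hc' (fun x hx => Set.Ioo_subset_Icc_self (hs' x hx).1)
      (fun x hx => (hs' x hx).2) (fun t ht => by rw [← iteratedDeriv_succ']; exact hS t ht)
    obtain ⟨ξ, hξ⟩ : s.Nonempty := Finset.card_pos.1 (by omega)
    have := abs_sub_le_of_abs_deriv_le (hf.differentiable (by simp)) hb ht (hs ξ hξ)
    rw [h0 ξ hξ, sub_zero] at this
    rw [pow_succ']
    linarith

lemma differentiable_iteratedDeriv_of_lt {f : ℝ → ℝ} {n j : ℕ} (hf : ContDiff ℝ n f)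
    (hj : j < n) : Differentiable ℝ (iteratedDeriv j f) :=
  hf.differentiable_iteratedDeriv j (by exact_mod_cast hj)

/-- A bounded function has, somewhere in `[p, q]`, a `j`-th derivative of size `(q - p) ^ (-j)`. -/
lemma exists_abs_iteratedDeriv_le (j : ℕ) :
    ∃ c : ℝ, 0 ≤ c ∧ ∀ {f : ℝ → ℝ}, ContDiff ℝ j f → ∀ {p q ε : ℝ}, p < q →
      (∀ t ∈ Set.Icc p q, |f t| ≤ ε) →
      ∃ ξ ∈ Set.Icc p q, |iteratedDeriv j f ξ| * (q - p) ^ j ≤ c * ε := by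
  induction j with
  | zero =>
    refine ⟨1, zero_le_one, fun {f} _ {p q ε} hpq h => ⟨p, ⟨le_rfl, hpq.le⟩, ?_⟩⟩
    simpa using h p ⟨le_rfl, hpq.le⟩
  | succ j ih =>
    obtain ⟨c, hc, ih⟩ := ih
    refine ⟨6 * 3 ^ j * c, by positivity, fun {f} hf {p q ε} hpq h => ?_⟩
    have hfj : ContDiff ℝ j f := hf.of_le (by exact_mod_cast Nat.le_succ j)
    set δ := (q - p) / 3 with hδ
    have hδ0 : 0 < δ := by rw [hδ]; linarith
    have hq : q = p + 3 * δ := by rw [hδ]; ring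
    obtain ⟨ξ, hξ, h1⟩ := ih hfj (p := p) (q := p + δ) (ε := ε) (by linarith)
      (fun t ht => h t ⟨ht.1, by linarith [ht.2]⟩)
    obtain ⟨η, hη, h2⟩ := ih hfj (p := p + 2 * δ) (q := p + 3 * δ) (ε := ε) (by linarith)
      (fun t ht => h t ⟨by linarith [ht.1], by linarith [ht.2]⟩)
    have hd := differentiable_iteratedDeriv_of_lt hf (Nat.lt_succ_self j)
    have hlt : ξ < η := by linarith [hξ.2, hη.1]
    obtain ⟨ζ, hζ, hm⟩ := exists_deriv_eq_slope (iteratedDeriv j f) hlt hd.continuous.continuousOn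
      hd.differentiableOn
    refine ⟨ζ, ⟨by linarith [hξ.1, hζ.1], by linarith [hη.2, hζ.2]⟩, ?_⟩
    rw [← iteratedDeriv_succ] at hm
    have e1 : (p + δ - p) = δ := by ring
    have e2 : (p + 3 * δ - (p + 2 * δ)) = δ := by ring
    have e3 : q - p = 3 * δ := by linarith
    rw [e1] at h1
    rw [e2] at h2
    have hpos : 0 < η - ξ := by linarith
    have hge : δ ≤ η - ξ := by linarith [hξ.2, hη.1]
    have h3 : |iteratedDeriv (j + 1) f ζ| * (η - ξ) ≤
        |iteratedDeriv j f η| + |iteratedDeriv j f ξ| := by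
      rw [hm, abs_div, abs_of_pos hpos, div_mul_cancel₀ _ hpos.ne']
      exact abs_sub _ _
    have h4 : |iteratedDeriv (j + 1) f ζ| * δ ≤ |iteratedDeriv j f η| + |iteratedDeriv j f ξ| :=
      (mul_le_mul_of_nonneg_left hge (abs_nonneg _)).trans h3
    have h5 : |iteratedDeriv (j + 1) f ζ| * δ * δ ^ j ≤ 2 * (c * ε) := by
      have := mul_le_mul_of_nonneg_right h4 (pow_nonneg hδ0.le j)
      linarith
    calc |iteratedDeriv (j + 1) f ζ| * (q - p) ^ (j + 1)
        = 3 * 3 ^ j * (|iteratedDeriv (j + 1) f ζ| * δ * δ ^ j) := by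
          rw [e3, mul_pow]; ring
      _ ≤ 3 * 3 ^ j * (2 * (c * ε)) := by gcongr
      _ = _ := by ring

/-- Landau–Kolmogorov interpolation inequality: intermediate derivatives are controlled by the
function and its `n`-th derivative. -/
lemma exists_abs_iteratedDeriv_le_interpolation (n : ℕ) :
    ∃ C : ℝ, 0 ≤ C ∧ ∀ {f : ℝ → ℝ}, ContDiff ℝ n f → ∀ {p q ε S : ℝ}, p < q →
      (∀ t ∈ Set.Icc p q, |f t| ≤ ε) → (∀ t ∈ Set.Icc p q, |iteratedDeriv n f t| ≤ S) →
      ∀ j ≤ n, ∀ t ∈ Set.Icc p q,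
        |iteratedDeriv j f t| * (q - p) ^ j ≤ C * ε + S * (q - p) ^ n := by
  choose c hc hcb using exists_abs_iteratedDeriv_le
  refine ⟨∑ i ∈ Finset.range n, c i, Finset.sum_nonneg fun i _ => hc i, ?_⟩
  intro f hf p q ε S hpq hε hS
  have hε0 : 0 ≤ ε := (abs_nonneg _).trans (hε p ⟨le_rfl, hpq.le⟩)
  have hδ : 0 < q - p := by linarith
  have main : ∀ m j : ℕ, j + m = n → ∀ t ∈ Set.Icc p q,
      |iteratedDeriv j f t| * (q - p) ^ j ≤
        (∑ i ∈ Finset.Ico j n, c i) * ε + S * (q - p) ^ n := by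
    intro m
    induction m with
    | zero =>
      intro j hj t ht
      obtain rfl : j = n := by omega
      simpa using mul_le_mul_of_nonneg_right (hS t ht) (pow_nonneg hδ.le j)
    | succ m ih =>
      intro j hj t ht
      have hjn : j < n := by omega
      obtain ⟨ξ, hξ, h1⟩ := hcb j (hf.of_le (by exact_mod_cast hjn.le)) hpq hε
      have hb : ∀ t ∈ Set.Icc p q, |deriv (iteratedDeriv j f) t| ≤
          ((∑ i ∈ Finset.Ico (j + 1) n, c i) * ε + S * (q - p) ^ n) / (q - p) ^ (j + 1) := by
        intro t ht
        rw [← iteratedDeriv_succ, le_div_iff₀ (by positivity)]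
        exact ih (j + 1) (by omega) t ht
      have h2 := abs_sub_le_of_abs_deriv_le (differentiable_iteratedDeriv_of_lt hf hjn) hb ht hξ
      have h3 : |iteratedDeriv j f t - iteratedDeriv j f ξ| * (q - p) ^ j ≤
          (∑ i ∈ Finset.Ico (j + 1) n, c i) * ε + S * (q - p) ^ n := by
        refine (mul_le_mul_of_nonneg_right h2 (pow_nonneg hδ.le j)).trans (le_of_eq ?_)
        rw [pow_succ']
        field_simp
      have h4 : |iteratedDeriv j f t| ≤
          |iteratedDeriv j f t - iteratedDeriv j f ξ| + |iteratedDeriv j f ξ| := by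
        have := abs_add_le (iteratedDeriv j f t - iteratedDeriv j f ξ) (iteratedDeriv j f ξ)
        simpa using this
      rw [Finset.sum_eq_sum_Ico_succ_bot hjn]
      have h5 := mul_le_mul_of_nonneg_right h4 (pow_nonneg hδ.le j)
      linarith
  intro j hj t ht
  refine (main (n - j) j (by omega) t ht).trans ?_
  rw [Finset.range_eq_Ico]
  have : ∑ i ∈ Finset.Ico j n, c i ≤ ∑ i ∈ Finset.Ico 0 n, c i :=
    Finset.sum_le_sum_of_subset_of_nonneg (Finset.Ico_subset_Ico_left (Nat.zero_le j))
      fun i _ _ => hc i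
  gcongr

/-- The unnormalised Legendre polynomial, in Rodrigues form. -/
noncomputable def rodrigues (n : ℕ) : Polynomial ℝ :=
  Polynomial.derivative^[n] ((Polynomial.X ^ 2 - 1) ^ n)

lemma iteratedDeriv_polynomial_eval (p : Polynomial ℝ) (n : ℕ) :
    iteratedDeriv n (fun t => p.eval t) = fun t => (Polynomial.derivative^[n] p).eval t := by
  induction n with
  | zero => simp
  | succ n ih =>
    rw [iteratedDeriv_succ, ih, Function.iterate_succ_apply']
    ext t
    exact Polynomial.deriv _

lemma legendre_eq_rodrigues (n : ℕ) (s : ℝ) :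
    legendre n s = (1 / ((2 : ℝ) ^ n * n.factorial)) * (rodrigues n).eval s := by
  have h : (fun t : ℝ => (t ^ 2 - 1) ^ n) =
      fun t => ((Polynomial.X ^ 2 - 1 : Polynomial ℝ) ^ n).eval t := by
    ext t; simp
  rw [legendre, h, iteratedDeriv_polynomial_eval, rodrigues]

lemma iterate_derivative_eval_eq_zero {n j : ℕ} (hj : j < n) {t : ℝ} (ht : t ^ 2 = 1) :
    (Polynomial.derivative^[j] ((Polynomial.X ^ 2 - 1 : Polynomial ℝ) ^ n)).eval t = 0 := by
  have h1 := Polynomial.pow_sub_dvd_iterate_derivative_pow (Polynomial.X ^ 2 - 1 : Polynomial ℝ) n j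
  have h2 := (dvd_pow_self (Polynomial.X ^ 2 - 1 : Polynomial ℝ) (by omega : n - j ≠ 0)).trans h1
  exact Polynomial.eval_eq_zero_of_dvd_of_eval_eq_zero h2 (by simp [ht])

lemma exists_zeros_iterate_derivative {n : ℕ} (j : ℕ) (hj : j ≤ n) :
    ∃ s : Finset ℝ, s.card = j ∧ ∀ t ∈ s, t ∈ Set.Ioo (-1 : ℝ) 1 ∧
      (Polynomial.derivative^[j] ((Polynomial.X ^ 2 - 1 : Polynomial ℝ) ^ n)).eval t = 0 := by
  induction j with
  | zero => exact ⟨∅, by simp⟩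
  | succ j ih =>
    obtain ⟨s, hc, hs⟩ := ih (by omega)
    set W := Polynomial.derivative^[j] ((Polynomial.X ^ 2 - 1 : Polynomial ℝ) ^ n) with hW
    have h1 : (1 : ℝ) ∉ s := fun h => lt_irrefl _ (hs _ h).1.2
    have h2 : (-1 : ℝ) ∉ insert 1 s := fun h => by
      rcases Finset.mem_insert.1 h with h | h
      · norm_num at h
      · exact lt_irrefl _ (hs _ h).1.1
    obtain ⟨s', hc', hs'⟩ := exists_finset_deriv_eq_zero (f := fun t => W.eval t) W.continuous
      (p := -1) (q := 1) (n := j + 1) (s := insert (-1) (insert 1 s))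
      (by
        intro x hx
        simp only [Finset.mem_insert] at hx
        rcases hx with rfl | rfl | hx
        · norm_num
        · norm_num
        · exact Set.Ioo_subset_Icc_self (hs x hx).1)
      (by rw [Finset.card_insert_of_notMem h2, Finset.card_insert_of_notMem h1, hc])
      (by
        intro x hx
        simp only [Finset.mem_insert] at hx
        rcases hx with rfl | rfl | hx
        · exact iterate_derivative_eval_eq_zero (by omega) (by norm_num)
        · exact iterate_derivative_eval_eq_zero (by omega) (by norm_num)
        · exact (hs x hx).2)
    refine ⟨s', hc', fun t ht => ⟨(hs' t ht).1, ?_⟩⟩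
    rw [Function.iterate_succ_apply', ← hW, ← Polynomial.deriv]
    exact (hs' t ht).2

/-- The Gauss points: `n` distinct zeros of the Legendre polynomial in `(-1, 1)`. -/
lemma exists_zeros_legendre (n : ℕ) :
    ∃ s : Finset ℝ, s.card = n ∧
      ∀ t ∈ s, t ∈ Set.Ioo (-1 : ℝ) 1 ∧ legendre n t = 0 ∧ (rodrigues n).eval t = 0 := by
  obtain ⟨s, hc, hs⟩ := exists_zeros_iterate_derivative (n := n) n le_rfl
  refine ⟨s, hc, fun t ht => ⟨(hs t ht).1, ?_, (hs t ht).2⟩⟩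
  rw [legendre_eq_rodrigues, rodrigues, (hs t ht).2, mul_zero]

lemma natDegree_rodrigues (n : ℕ) : (rodrigues n).natDegree = n := by
  have hX : (Polynomial.X ^ 2 - 1 : Polynomial ℝ) = Polynomial.X ^ 2 - Polynomial.C 1 := by simp
  have hmon : (Polynomial.X ^ 2 - 1 : Polynomial ℝ).Monic := by
    rw [hX]; exact Polynomial.monic_X_pow_sub_C 1 two_ne_zero
  have hdeg : ((Polynomial.X ^ 2 - 1 : Polynomial ℝ) ^ n).natDegree = n + n := by
    rw [hmon.natDegree_pow, hX, Polynomial.natDegree_X_pow_sub_C]; ring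
  apply le_antisymm
  · have := Polynomial.natDegree_iterate_derivative ((Polynomial.X ^ 2 - 1 : Polynomial ℝ) ^ n) n
    rw [hdeg] at this
    simpa [rodrigues] using this
  · apply Polynomial.le_natDegree_of_ne_zero
    rw [rodrigues, Polynomial.coeff_iterate_derivative]
    have h1 : ((Polynomial.X ^ 2 - 1 : Polynomial ℝ) ^ n).coeff (n + n) = 1 := by
      rw [← hdeg]; exact (hmon.pow n).coeff_natDegree
    rw [h1]
    simp

lemma integral_iterate_derivative_mul_eq_zero (V : Polynomial ℝ) (p q : ℝ) (m : ℕ) :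
    ∀ A : Polynomial ℝ, Polynomial.derivative^[m] A = 0 →
      (∀ j < m, (Polynomial.derivative^[j] V).eval p = 0 ∧
        (Polynomial.derivative^[j] V).eval q = 0) →
      ∫ t in p..q, (Polynomial.derivative^[m] V).eval t * A.eval t = 0 := by
  induction m with
  | zero => intro A hA _; simp only [Function.iterate_zero, id] at hA; simp [hA]
  | succ m ih =>
    intro A hA hV
    have hA' : Polynomial.derivative^[m] (Polynomial.derivative A) = 0 := by
      rwa [Function.iterate_succ_apply] at hA
    have h1 := ih _ hA' fun j hj => hV j (by omega)
    have h2 := integral_mul_deriv_eq_deriv_mul (a := p) (b := q)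
      (u := fun t => (Polynomial.derivative^[m] V).eval t) (v := fun t => A.eval t)
      (fun x _ => Polynomial.hasDerivAt _ x) (fun x _ => Polynomial.hasDerivAt _ x)
      ((Polynomial.continuous _).intervalIntegrable _ _)
      ((Polynomial.continuous _).intervalIntegrable _ _)
    rw [h1, (hV m (by omega)).1, (hV m (by omega)).2] at h2
    rw [Function.iterate_succ_apply']
    linarith

/-- Exactness of Gauss quadrature on `[-1, 1]`, for polynomials vanishing at all Gauss points. -/
lemma integral_eq_zero_of_eval_gauss {n : ℕ} {s : Finset ℝ} (hc : s.card = n)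
    (hs : ∀ t ∈ s, (rodrigues n).eval t = 0) {T : Polynomial ℝ} (hT : T.natDegree < 2 * n)
    (h0 : ∀ t ∈ s, T.eval t = 0) : ∫ t in (-1 : ℝ)..1, T.eval t = 0 := by
  have hn : 0 < n := by omega
  have hne : rodrigues n ≠ 0 := fun h => by
    have := natDegree_rodrigues n
    rw [h, Polynomial.natDegree_zero] at this
    omega
  have hmod : T % rodrigues n = 0 := by
    apply Polynomial.eq_zero_of_natDegree_lt_card_of_eval_eq_zero' _ s
    · intro t ht
      have := congrArg (Polynomial.eval t) (EuclideanDomain.div_add_mod T (rodrigues n))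
      rw [Polynomial.eval_add, Polynomial.eval_mul, hs t ht, h0 t ht] at this
      linarith
    · rw [hc]
      have := Polynomial.natDegree_mod_lt T (q := rodrigues n) (by rw [natDegree_rodrigues]; omega)
      rwa [natDegree_rodrigues] at this
  obtain ⟨A, rfl⟩ := (EuclideanDomain.mod_eq_zero).1 hmod
  by_cases hA : A = 0
  · simp [hA]
  have hdeg : A.natDegree < n := by
    rw [Polynomial.natDegree_mul hne hA, natDegree_rodrigues] at hT
    omega
  simp only [Polynomial.eval_mul]
  exact integral_iterate_derivative_mul_eq_zero _ _ _ n A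
    (Polynomial.iterate_derivative_eq_zero hdeg)
    fun j hj => ⟨iterate_derivative_eval_eq_zero hj (by norm_num),
      iterate_derivative_eval_eq_zero hj (by norm_num)⟩

lemma affMap_mem_Icc {p q s : ℝ} (hpq : p < q) (hs : s ∈ Set.Ioo (-1 : ℝ) 1) :
    affMap p q s ∈ Set.Icc p q := by
  unfold affMap
  constructor <;> nlinarith [hs.1, hs.2]

lemma affMap_injective {p q : ℝ} (hpq : p < q) : Function.Injective (affMap p q) := by
  intro s t h
  unfold affMap at h
  have : q - p ≠ 0 := by linarith
  have h2 : (s - t) * (q - p) = 0 := by linarith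
  rcases mul_eq_zero.1 h2 with h3 | h3
  · linarith
  · exact absurd h3 this

/-- Integrals of functions vanishing at the Gauss points of `[p, q]` are of the order of the Gauss
quadrature error. -/
lemma abs_integral_le_of_zero_gauss {n : ℕ} {f : ℝ → ℝ} (hf : ContDiff ℝ (2 * n : ℕ) f) {p q S : ℝ}
    (hpq : p < q)
    (h0 : ∀ s ∈ Set.Ioo (-1 : ℝ) 1, legendre n s = 0 → f (affMap p q s) = 0)
    (hS : ∀ t ∈ Set.Icc p q, |iteratedDeriv (2 * n) f t| ≤ S) :
    |∫ t in p..q, f t| ≤ (q - p) ^ (2 * n) * S * (q - p) := by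
  classical
  obtain ⟨s, hc, hs⟩ := exists_zeros_legendre n
  set G : Finset ℝ := s.image (affMap p q) with hG
  have hGc : G.card = n := by
    rw [hG, Finset.card_image_of_injective _ (affMap_injective hpq), hc]
  have hGI : ∀ x ∈ G, x ∈ Set.Icc p q := by
    intro x hx
    obtain ⟨t, ht, rfl⟩ := Finset.mem_image.1 hx
    exact affMap_mem_Icc hpq (hs t ht).1
  obtain ⟨Z, hGZ, hZI, hZc⟩ : ∃ Z : Finset ℝ, G ⊆ Z ∧ (∀ x ∈ Z, x ∈ Set.Icc p q) ∧
      Z.card = 2 * n := by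
    obtain ⟨Z, hZ1, hZ2, hZ3⟩ := (Set.Icc_infinite hpq).exists_superset_ncard_eq
      (s := (G : Set ℝ)) (fun x hx => hGI x hx) G.finite_toSet (k := 2 * n)
      (by rw [Set.ncard_coe_finset, hGc]; omega)
    have hfin : Z.Finite ∨ n = 0 := by
      by_cases hn : n = 0
      · exact Or.inr hn
      · exact Or.inl (Set.finite_of_ncard_ne_zero (by omega))
    rcases hfin with hfin | hn
    · refine ⟨hfin.toFinset, ?_, ?_, ?_⟩
      · intro x hx; exact hfin.mem_toFinset.2 (hZ1 hx)
      · intro x hx; exact hZ2 (hfin.mem_toFinset.1 hx)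
      · rw [← Set.ncard_eq_toFinset_card Z hfin, hZ3]
    · exact ⟨G, subset_rfl, hGI, by omega⟩
  set T := Lagrange.interpolate Z id f with hTdef
  have hTZ : ∀ x ∈ Z, T.eval x = f x := fun x hx =>
    Lagrange.eval_interpolate_at_node (v := id) f (Set.injOn_id _) hx
  have hTG : ∀ x ∈ G, T.eval x = 0 := by
    intro x hx
    rw [hTZ x (hGZ hx)]
    obtain ⟨t, ht, rfl⟩ := Finset.mem_image.1 hx
    exact h0 t (hs t ht).1 (hs t ht).2.1
  have hTdeg : T.degree < (2 * n : ℕ) := by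
    have := Lagrange.degree_interpolate_lt (s := Z) (v := id) f (Set.injOn_id _)
    rwa [hZc] at this
  have hTD : Polynomial.derivative^[2 * n] T = 0 :=
    Polynomial.iterate_derivative_eq_zero_of_degree_lt hTdeg
  have hTint : ∫ t in p..q, T.eval t = 0 := by
    rcases Nat.eq_zero_or_pos n with hn | hn
    · subst hn
      have : T = 0 := by simpa using hTD
      simp [this]
    set ℓ : Polynomial ℝ :=
      Polynomial.C ((q - p) / 2) * Polynomial.X + Polynomial.C ((p + q) / 2) with hℓ
    have hℓe : ∀ t, (T.comp ℓ).eval t = T.eval (affMap p q t) := by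
      intro t
      rw [Polynomial.eval_comp, hℓ, affMap]
      congr 1
      simp
      ring
    have hT1 : T.natDegree < 2 * n := by
      by_cases hT0 : T = 0
      · simp [hT0]; omega
      · exact (Polynomial.natDegree_lt_iff_degree_lt hT0).2 hTdeg
    have hz : ∫ t in (-1 : ℝ)..1, (T.comp ℓ).eval t = 0 := by
      refine integral_eq_zero_of_eval_gauss hc (fun t ht => (hs t ht).2.2) ?_ ?_
      · refine lt_of_le_of_lt Polynomial.natDegree_comp_le ?_
        have : ℓ.natDegree ≤ 1 := Polynomial.natDegree_linear_le
        nlinarith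
      · intro t ht
        rw [hℓe]
        exact hTG _ (Finset.mem_image_of_mem _ ht)
    have hsub := intervalIntegral.integral_comp_mul_add (a := -1) (b := 1)
      (fun t => T.eval t) (c := (q - p) / 2) (by linarith) ((p + q) / 2)
    have h3 : ∫ t in (-1 : ℝ)..1, T.eval ((q - p) / 2 * t + (p + q) / 2) = 0 := by
      rw [← hz]
      congr 1
      ext t
      rw [hℓe, affMap]
      congr 1
      ring
    rw [h3] at hsub
    have e1 : (q - p) / 2 * (-1) + (p + q) / 2 = p := by ring
    have e2 : (q - p) / 2 * 1 + (p + q) / 2 = q := by ring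
    rw [e1, e2, smul_eq_mul] at hsub
    exact (mul_eq_zero.1 hsub.symm).resolve_left (inv_ne_zero (by linarith))
  have hTc : ContDiff ℝ (2 * n : ℕ) fun t => T.eval t := by
    simpa using T.contDiff_aeval (𝕜 := ℝ) (2 * n : ℕ)
  have hbound : ∀ t ∈ Set.Icc p q, |(f - fun t => T.eval t) t| ≤ (q - p) ^ (2 * n) * S := by
    refine abs_le_pow_mul_of_zeros (2 * n) (hf.sub hTc) hZc hZI ?_ ?_
    · intro x hx
      simp [hTZ x hx]
    · intro t ht
      rw [iteratedDeriv_sub hf.contDiffAt hTc.contDiffAt, iteratedDeriv_polynomial_eval, hTD]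
      simpa using hS t ht
  have hsplit : ∫ t in p..q, f t = ∫ t in p..q, (f - fun t => T.eval t) t := by
    simp only [Pi.sub_apply]
    rw [intervalIntegral.integral_sub (hf.continuous.intervalIntegrable _ _)
      (T.continuous.intervalIntegrable _ _), hTint, sub_zero]
  rw [hsplit]
  have := intervalIntegral.norm_integral_le_of_norm_le_const (a := p) (b := q)
    (f := f - fun t => T.eval t) (C := (q - p) ^ (2 * n) * S) (fun t ht => by
      rw [Set.uIoc_of_le hpq.le] at ht
      exact hbound t (Set.Ioc_subset_Icc_self ht))
  rwa [abs_of_pos (by linarith : 0 < q - p)] at this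

/-- The operator `e'' - b e' - c e`. -/
noncomputable def odeResidual (b c : ℝ) (e : ℝ → ℝ) (t : ℝ) : ℝ :=
  deriv (deriv e) t - b * deriv e t - c * e t

lemma contDiff_odeResidual {b c : ℝ} {e : ℝ → ℝ} {m : ℕ} (he : ContDiff ℝ (m + 2 : ℕ) e) :
    ContDiff ℝ m (odeResidual b c e) := by
  have h1 : ContDiff ℝ (m + 1 : ℕ) (deriv e) := contDiff_deriv_of_succ he
  have h2 : ContDiff ℝ m (deriv (deriv e)) := contDiff_deriv_of_succ h1
  have h1' : ContDiff ℝ m (deriv e) := h1.of_le (by exact_mod_cast Nat.le_succ m)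
  have h0 : ContDiff ℝ m e := he.of_le (by exact_mod_cast Nat.le_add_right m 2)
  exact (h2.sub (contDiff_const.mul h1')).sub (contDiff_const.mul h0)

lemma iteratedDeriv_odeResidual {b c : ℝ} {e : ℝ → ℝ} {m : ℕ} (he : ContDiff ℝ (m + 2 : ℕ) e)
    (t : ℝ) : iteratedDeriv m (odeResidual b c e) t =
      iteratedDeriv (m + 2) e t - b * iteratedDeriv (m + 1) e t - c * iteratedDeriv m e t := by
  have h1 : ContDiff ℝ (m + 1 : ℕ) (deriv e) := contDiff_deriv_of_succ he
  have h2 : ContDiff ℝ m (deriv (deriv e)) := contDiff_deriv_of_succ h1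
  have h1' : ContDiff ℝ m (deriv e) := h1.of_le (by exact_mod_cast Nat.le_succ m)
  have h0 : ContDiff ℝ m e := he.of_le (by exact_mod_cast Nat.le_add_right m 2)
  have h3 : ContDiff ℝ m fun t => b * deriv e t := contDiff_const.mul h1'
  have h4 : ContDiff ℝ m fun t => c * e t := contDiff_const.mul h0
  have hr : odeResidual b c e = (deriv (deriv e) - fun t => b * deriv e t) - fun t => c * e t := rfl
  have h5 : ContDiff ℝ m (deriv (deriv e) - fun t => b * deriv e t) := h2.sub h3
  rw [hr, iteratedDeriv_sub h5.contDiffAt h4.contDiffAt,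
    iteratedDeriv_sub h2.contDiffAt h3.contDiffAt, iteratedDeriv_succ', iteratedDeriv_succ']
  simp only [iteratedDeriv_const_mul_field, iteratedDeriv_succ']

/-- `g` is the fundamental solution of `g'' = b g' + c g`, and it does not vanish at `d`. -/
structure IsFundamental (b c d : ℝ) (g : ℝ → ℝ) : Prop where
  smooth : ∀ n : ℕ, ContDiff ℝ n g
  ode : ∀ z, deriv (deriv g) z = b * deriv g z + c * g z
  zero : g 0 = 0
  one : deriv g 0 = 1
  ne_zero : g d ≠ 0

lemma exists_isFundamental {b c d : ℝ} (hc : 0 ≤ c) (hd : 0 < d) : ∃ g, IsFundamental b c d g := by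
  by_cases hD : b ^ 2 + 4 * c = 0
  · have hb : b = 0 := by nlinarith [sq_nonneg b]
    have hc : c = 0 := by nlinarith [sq_nonneg b]
    subst hb hc
    refine ⟨id, fun n => contDiff_id, fun z => ?_, rfl, by simp, hd.ne'⟩
    have : deriv (id : ℝ → ℝ) = fun _ => 1 := by ext; simp
    rw [this]; simp
  · have hpos : 0 < b ^ 2 + 4 * c := lt_of_le_of_ne (by positivity) (Ne.symm hD)
    set D := √(b ^ 2 + 4 * c) with hDdef
    have hDpos : 0 < D := Real.sqrt_pos.2 hpos
    have hDsq : D ^ 2 = b ^ 2 + 4 * c := Real.sq_sqrt hpos.le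
    have hexp : ∀ r z : ℝ, HasDerivAt (fun z => Real.exp (r * z)) (r * Real.exp (r * z)) z := by
      intro r z
      have := ((hasDerivAt_id z).const_mul r).exp
      simpa [mul_comm] using this
    set r₁ := (b - D) / 2 with hr₁
    set r₂ := (b + D) / 2 with hr₂
    have h1 : r₁ * r₁ = b * r₁ + c := by rw [hr₁]; linarith
    have h2 : r₂ * r₂ = b * r₂ + c := by rw [hr₂]; linarith
    have hd1 : deriv (fun z => (Real.exp (r₂ * z) - Real.exp (r₁ * z)) / D) =
        fun z => (r₂ * Real.exp (r₂ * z) - r₁ * Real.exp (r₁ * z)) / D := by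
      ext z
      exact (((hexp r₂ z).sub (hexp r₁ z)).div_const D).deriv
    have hd2 : deriv (fun z => (r₂ * Real.exp (r₂ * z) - r₁ * Real.exp (r₁ * z)) / D) =
        fun z => (r₂ * (r₂ * Real.exp (r₂ * z)) - r₁ * (r₁ * Real.exp (r₁ * z))) / D := by
      ext z
      exact ((((hexp r₂ z).const_mul r₂).sub ((hexp r₁ z).const_mul r₁)).div_const D).deriv
    refine ⟨fun z => (Real.exp (r₂ * z) - Real.exp (r₁ * z)) / D, fun n => by fun_prop,
      fun z => ?_, by simp, ?_, ?_⟩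
    · rw [hd1, hd2]
      simp only [← mul_assoc]
      rw [h1, h2]
      ring
    · rw [hd1]
      simp only [mul_zero, Real.exp_zero, mul_one]
      rw [div_eq_one_iff_eq hDpos.ne', hr₁, hr₂]
      ring
    · apply div_ne_zero _ hDpos.ne'
      rw [sub_ne_zero]
      intro h
      have := Real.exp_injective h
      have h3 : (r₂ - r₁) * d = 0 := by linarith
      have h4 : r₂ - r₁ = D := by rw [hr₁, hr₂]; ring
      rw [h4] at h3
      exact (mul_pos hDpos hd).ne' h3

/-- Lagrange's bilinear form of `e` and `G (y - ·)`. -/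
noncomputable def bilinearForm (b : ℝ) (G e : ℝ → ℝ) (y t : ℝ) : ℝ :=
  G (y - t) * deriv e t + (deriv G (y - t) - b * G (y - t)) * e t

/-- Lagrange's identity. -/
lemma bilinearForm_sub_eq_integral {b c : ℝ} {G e : ℝ → ℝ} (hG : ContDiff ℝ 2 G)
    (hode : ∀ z, deriv (deriv G) z = b * deriv G z + c * G z) (he : ContDiff ℝ 2 e) (y p q : ℝ) :
    bilinearForm b G e y q - bilinearForm b G e y p =
      ∫ t in p..q, G (y - t) * odeResidual b c e t := by
  symm
  have hG' : ContDiff ℝ 1 (deriv G) := contDiff_deriv_of_succ (n := 1) (by exact_mod_cast hG)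
  have he' : ContDiff ℝ 1 (deriv e) := contDiff_deriv_of_succ (n := 1) (by exact_mod_cast he)
  refine intervalIntegral.integral_eq_sub_of_hasDerivAt (fun t _ => ?_) ?_
  · have h1 : HasDerivAt (fun t => G (y - t)) (-deriv G (y - t)) t := by
      simpa using (hG.differentiable two_ne_zero (y - t)).hasDerivAt.comp_const_sub y t
    have h2 : HasDerivAt (fun t => deriv G (y - t)) (-deriv (deriv G) (y - t)) t := by
      simpa using (hG'.differentiable one_ne_zero (y - t)).hasDerivAt.comp_const_sub y t
    have h3 := (he.differentiable two_ne_zero t).hasDerivAt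
    have h4 := (he'.differentiable one_ne_zero t).hasDerivAt
    have h5 := (h1.mul h4).add ((h2.sub (h1.const_mul b)).mul h3)
    refine HasDerivAt.congr_deriv h5 ?_
    rw [hode, odeResidual]
    simp only [Pi.sub_apply]
    ring
  · have h0 : Continuous (odeResidual b c e) :=
      (contDiff_odeResidual (m := 0) (by exact_mod_cast he)).continuous
    exact ((hG.continuous.comp (continuous_const.sub continuous_id)).mul h0).intervalIntegrable _ _

/-- Leibniz bound for the derivatives of a product. -/
lemma abs_iteratedDeriv_mul_le {m : ℕ} {f g : ℝ → ℝ} (hf : ContDiff ℝ m f) (hg : ContDiff ℝ m g)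
    {t A B : ℝ} (hA : ∀ j ≤ m, |iteratedDeriv j f t| ≤ A)
    (hB : ∀ j ≤ m, |iteratedDeriv j g t| ≤ B) :
    |iteratedDeriv m (f * g) t| ≤ 2 ^ m * A * B := by
  rw [iteratedDeriv_mul hf.contDiffAt hg.contDiffAt]
  have hA0 : 0 ≤ A := (abs_nonneg _).trans (hA 0 (Nat.zero_le m))
  have hsum : ((2 : ℝ) ^ m) = ∑ i ∈ Finset.range (m + 1), (m.choose i : ℝ) := by
    exact_mod_cast (Nat.sum_range_choose m).symm
  rw [hsum, Finset.sum_mul, Finset.sum_mul]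
  refine (Finset.abs_sum_le_sum_abs _ _).trans (Finset.sum_le_sum fun i hi => ?_)
  have hi' : i ≤ m := Nat.lt_succ_iff.1 (Finset.mem_range.1 hi)
  rw [abs_mul, abs_mul, Nat.abs_cast]
  gcongr
  · exact hA i hi'
  · exact hB _ (Nat.sub_le m i)

/-- The quantity integrated in Lagrange's identity is of the size of the Gauss quadrature error
when the residual vanishes at the Gauss points. -/
lemma abs_integral_mul_odeResidual_le {n : ℕ} {b c d : ℝ} {G e : ℝ → ℝ}
    (hG : ContDiff ℝ (2 * n : ℕ) G)
    (he : ContDiff ℝ (2 * n + 2 : ℕ) e) {K S p q y : ℝ}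
    (hK : ∀ j ≤ 2 * n, ∀ z ∈ Set.Icc 0 d, |iteratedDeriv j G z| ≤ K)
    (hS : ∀ j ≤ 2 * n, ∀ t ∈ Set.Icc p q, |iteratedDeriv j (odeResidual b c e) t| ≤ S)
    (hpq : p < q) (hy : q ≤ y) (hyd : y ≤ p + d)
    (h0 : ∀ s ∈ Set.Ioo (-1 : ℝ) 1, legendre n s = 0 → odeResidual b c e (affMap p q s) = 0) :
    |∫ t in p..q, G (y - t) * odeResidual b c e t| ≤
      (q - p) ^ (2 * n) * (2 ^ (2 * n) * K * S) * (q - p) := by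
  have hGy : ContDiff ℝ (2 * n : ℕ) fun t => G (y - t) := hG.comp (contDiff_const.sub contDiff_id)
  have hR : ContDiff ℝ (2 * n : ℕ) (odeResidual b c e) := contDiff_odeResidual he
  refine abs_integral_le_of_zero_gauss (hGy.mul hR) hpq
    (fun s hs hl => by rw [h0 s hs hl, mul_zero]) fun t ht => ?_
  refine abs_iteratedDeriv_mul_le hGy hR (fun j hj => ?_) fun j hj => hS j hj t ht
  rw [iteratedDeriv_comp_const_sub]
  simp only [smul_eq_mul, abs_mul, abs_pow, abs_neg, abs_one, one_pow, one_mul]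
  exact hK j hj _ ⟨by linarith [ht.2], by linarith [ht.1]⟩

/-- Local consistency: on an element, a residual vanishing at the Gauss points is small. -/
lemma exists_abs_odeResidual_le (n : ℕ) (hn : 2 ≤ n) (b c : ℝ) :
    ∃ C : ℝ, 0 ≤ C ∧ ∀ {e : ℝ → ℝ}, ContDiff ℝ (n + 2 : ℕ) e → ∀ {p q E M : ℝ}, p < q →
      q - p ≤ 1 → (∀ t ∈ Set.Icc p q, |iteratedDeriv 2 e t| ≤ E) →
      (∀ t ∈ Set.Icc p q, |iteratedDeriv (n + 2) e t| ≤ M) →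
      (∀ s ∈ Set.Ioo (-1 : ℝ) 1, legendre n s = 0 → odeResidual b c e (affMap p q s) = 0) →
      ∀ t ∈ Set.Icc p q, |odeResidual b c e t| ≤ C * (M * (q - p) ^ n + (q - p) * E) := by
  obtain ⟨C, hC, hLK⟩ := exists_abs_iteratedDeriv_le_interpolation n
  refine ⟨1 + (|b| + |c|) * (C + 1), by positivity, ?_⟩
  intro e he p q E M hpq hδ1 hE hM h0 t ht
  classical
  set δ := q - p with hδ
  have hδ0 : 0 < δ := by rw [hδ]; linarith
  have hE0 : 0 ≤ E := (abs_nonneg _).trans (hE t ht)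
  have hM0 : 0 ≤ M := (abs_nonneg _).trans (hM t ht)
  have he2 : ContDiff ℝ n (iteratedDeriv 2 e) := by
    rw [iteratedDeriv_succ, iteratedDeriv_one]
    exact contDiff_deriv_of_succ (contDiff_deriv_of_succ (n := n + 1) he)
  have hit : ∀ j, iteratedDeriv j (iteratedDeriv 2 e) = iteratedDeriv (j + 2) e := fun j => by
    simp only [iteratedDeriv_eq_iterate, ← Function.iterate_add_apply]
  have hL := hLK he2 hpq hE (by rw [hit]; exact hM)
  have hn2 : n - 2 + 2 = n := by omega
  have hn1 : n - 1 + 2 = n + 1 := by omega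
  obtain ⟨s, hsc, hs⟩ := exists_zeros_legendre n
  have hR : ContDiff ℝ n (odeResidual b c e) := contDiff_odeResidual he
  set B := C * E + M * δ ^ n with hB
  have hB0 : 0 ≤ B := by positivity
  have key : ∀ t ∈ Set.Icc p q, |iteratedDeriv n (odeResidual b c e) t| ≤
      (M * δ ^ n + (|b| + |c|) * (δ * B)) / δ ^ n := by
    intro t ht
    rw [le_div_iff₀ (by positivity), iteratedDeriv_odeResidual he]
    have a1 := hL (n - 1) (by omega) t ht
    have a2 := hL (n - 2) (by omega) t ht
    rw [hit, hn1] at a1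
    rw [hit, hn2] at a2
    have p1 : δ ^ n = δ ^ (n - 1) * δ := by rw [← pow_succ]; congr 1; omega
    have p2 : δ ^ n = δ ^ (n - 2) * δ * δ := by rw [← pow_succ, ← pow_succ]; congr 1; omega
    have b1 : |iteratedDeriv (n + 1) e t| * δ ^ n ≤ δ * B := by
      rw [p1, ← mul_assoc, mul_comm δ B]; gcongr
    have b2 : |iteratedDeriv n e t| * δ ^ n ≤ δ * B := by
      calc |iteratedDeriv n e t| * δ ^ n = |iteratedDeriv n e t| * δ ^ (n - 2) * δ * δ := by
            rw [p2]; ring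
        _ ≤ B * δ * 1 := by gcongr
        _ = δ * B := by ring
    have b3 : |iteratedDeriv (n + 2) e t| * δ ^ n ≤ M * δ ^ n := by gcongr; exact hM t ht
    have tri : |iteratedDeriv (n + 2) e t - b * iteratedDeriv (n + 1) e t - c * iteratedDeriv n e t|
        ≤ |iteratedDeriv (n + 2) e t| + |b| * |iteratedDeriv (n + 1) e t| +
          |c| * |iteratedDeriv n e t| := by
      rw [← abs_mul, ← abs_mul]
      exact (abs_sub _ _).trans (add_le_add_left (abs_sub _ _) _)
    calc _ ≤ (|iteratedDeriv (n + 2) e t| + |b| * |iteratedDeriv (n + 1) e t| +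
          |c| * |iteratedDeriv n e t|) * δ ^ n := by gcongr
      _ = |iteratedDeriv (n + 2) e t| * δ ^ n + |b| * (|iteratedDeriv (n + 1) e t| * δ ^ n) +
          |c| * (|iteratedDeriv n e t| * δ ^ n) := by ring
      _ ≤ M * δ ^ n + |b| * (δ * B) + |c| * (δ * B) := by gcongr
      _ = _ := by ring
  have hz := abs_le_pow_mul_of_zeros n hR (s := s.image (affMap p q))
    (by rw [Finset.card_image_of_injective _ (affMap_injective hpq), hsc])
    (fun x hx => by
      obtain ⟨r, hr, rfl⟩ := Finset.mem_image.1 hx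
      exact affMap_mem_Icc hpq (hs r hr).1)
    (fun x hx => by
      obtain ⟨r, hr, rfl⟩ := Finset.mem_image.1 hx
      exact h0 r (hs r hr).1 (hs r hr).2.1) key t ht
  refine hz.trans ?_
  rw [← hδ, mul_div_cancel₀ _ (by positivity)]
  have hfin : δ * B ≤ (C + 1) * (M * δ ^ n + δ * E) := by
    have q1 : δ * (M * δ ^ n) ≤ 1 * (M * δ ^ n) := by gcongr
    have q2 : 0 ≤ C * (M * δ ^ n) := by positivity
    have q3 : 0 ≤ δ * E := by positivity
    rw [hB]; linarith
  have hbc : 0 ≤ |b| + |c| := by positivity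
  have := mul_le_mul_of_nonneg_left hfin hbc
  have : 0 ≤ δ * E := by positivity
  linarith

/-- The integrals in Lagrange's identity for the broken function `e`, from `x 0` up to the point `y`
of the `j`-th element, are bounded by `κ` times the lengths of the integration intervals. -/
def HasSmallMoments (b c κ : ℝ) (x : ℕ → ℝ) (e : ℕ → ℝ → ℝ) (G : ℝ → ℝ) (j : ℕ) (y : ℝ) : Prop :=
  (∀ i, 1 ≤ i → i < j →
    |∫ t in x (i - 1)..x i, G (y - t) * odeResidual b c (e i) t| ≤ κ * (x i - x (i - 1))) ∧
  |∫ t in x (j - 1)..y, G (y - t) * odeResidual b c (e j) t| ≤ κ * (y - x (j - 1))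

/-- The error of a collocation method on the mesh `x`: a broken function whose pieces match to first
order at the interior nodes, vanishing at both ends, whose residual vanishes at the `n` Gauss points
of each element, and whose derivatives of order `n + 2, …, 2 n + 2` are bounded by `M`. -/
structure IsCollocationError (n : ℕ) (b c : ℝ) (N : ℕ) (x : ℕ → ℝ) (M : ℝ) (e : ℕ → ℝ → ℝ) :
    Prop where
  smooth : ∀ i ∈ Finset.Icc 1 N, ContDiff ℝ (2 * n + 2 : ℕ) (e i)
  val : ∀ i ∈ Finset.Icc 1 (N - 1), e i (x i) = e (i + 1) (x i)
  der : ∀ i ∈ Finset.Icc 1 (N - 1), deriv (e i) (x i) = deriv (e (i + 1)) (x i)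
  left : e 1 (x 0) = 0
  right : e N (x N) = 0
  gauss : ∀ i ∈ Finset.Icc 1 N, ∀ s ∈ Set.Ioo (-1 : ℝ) 1, legendre n s = 0 →
    odeResidual b c (e i) (affMap (x (i - 1)) (x i) s) = 0
  high : ∀ i ∈ Finset.Icc 1 N, ∀ j, n + 2 ≤ j → j ≤ 2 * n + 2 →
    ∀ t ∈ Set.Icc (x (i - 1)) (x i), |iteratedDeriv j (e i) t| ≤ M

lemma IsMesh.le {a b : ℝ} {N : ℕ} {x : ℕ → ℝ} (hx : IsMesh a b N x) {i j : ℕ} (hij : i ≤ j)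
    (hj : j ≤ N) : x i ≤ x j := by
  induction j, hij using Nat.le_induction with
  | base => exact le_rfl
  | succ m _ ih => exact (ih (by omega)).trans (hx.2.2.2 m (by omega)).le

lemma IsMesh.lt {a b : ℝ} {N : ℕ} {x : ℕ → ℝ} (hx : IsMesh a b N x) {i : ℕ}
    (hi : i ∈ Finset.Icc 1 N) : x (i - 1) < x i := by
  rw [Finset.mem_Icc] at hi
  have := hx.2.2.2 (i - 1) (by omega)
  rwa [Nat.sub_add_cancel hi.1] at this

lemma abs_sub_le_of_increments {N : ℕ} {x : ℕ → ℝ} {F : ℕ → ℝ → ℝ} {κ : ℝ}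
    (hF : ∀ i ∈ Finset.Icc 1 (N - 1), F i (x i) = F (i + 1) (x i)) (j : ℕ) (hj : 1 ≤ j)
    (hjN : j ≤ N)
    (h : ∀ i, 1 ≤ i → i < j → |F i (x i) - F i (x (i - 1))| ≤ κ * (x i - x (i - 1))) :
    |F j (x (j - 1)) - F 1 (x 0)| ≤ κ * (x (j - 1) - x 0) := by
  induction j, hj using Nat.le_induction with
  | base => simp
  | succ m hm ih =>
    have h1 := ih (by omega) fun i hi hi' => h i hi (by omega)
    have h2 := h m hm (Nat.lt_succ_self m)
    rw [Nat.add_sub_cancel, ← hF m (Finset.mem_Icc.2 ⟨hm, by omega⟩)]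
    have h3 := abs_add_le (F m (x m) - F m (x (m - 1))) (F m (x (m - 1)) - F 1 (x 0))
    rw [sub_add_sub_cancel] at h3
    linarith

lemma HasSmallMoments.duhamel {n : ℕ} {b c κ M : ℝ} {N : ℕ} {x : ℕ → ℝ} {e : ℕ → ℝ → ℝ}
    {G : ℝ → ℝ} (he : IsCollocationError n b c N x M e) (hG : ContDiff ℝ 2 G)
    (hode : ∀ z, deriv (deriv G) z = b * deriv G z + c * G z) {j : ℕ} {y : ℝ}
    (hj : j ∈ Finset.Icc 1 N) (h : HasSmallMoments b c κ x e G j y) :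
    |G 0 * deriv (e j) y + (deriv G 0 - b * G 0) * e j y - G (y - x 0) * deriv (e 1) (x 0)| ≤
      κ * (y - x 0) := by
  rw [Finset.mem_Icc] at hj
  have hs : ∀ i, 1 ≤ i → i ≤ N → ContDiff ℝ 2 (e i) := fun i hi hi' =>
    (he.smooth i (Finset.mem_Icc.2 ⟨hi, hi'⟩)).of_le (by exact_mod_cast Nat.le_add_left 2 (2 * n))
  have h1 := abs_sub_le_of_increments (N := N) (x := x) (κ := κ)
    (F := fun i => bilinearForm b G (e i) y)
    (fun i hi => by simp only [bilinearForm]; rw [he.val i hi, he.der i hi]) j hj.1 hj.2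
    (fun i hi hi' => by
      rw [bilinearForm_sub_eq_integral hG hode (hs i hi (by omega))]
      exact h.1 i hi hi')
  have h2 := h.2
  rw [← bilinearForm_sub_eq_integral hG hode (hs j hj.1 hj.2)] at h2
  have h3 := abs_add_le (bilinearForm b G (e j) y y - bilinearForm b G (e j) y (x (j - 1)))
    (bilinearForm b G (e j) y (x (j - 1)) - bilinearForm b G (e 1) y (x 0))
  rw [sub_add_sub_cancel] at h3
  have e1 : bilinearForm b G (e j) y y = G 0 * deriv (e j) y + (deriv G 0 - b * G 0) * e j y := by
    simp [bilinearForm]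
  have e2 : bilinearForm b G (e 1) y (x 0) = G (y - x 0) * deriv (e 1) (x 0) := by
    simp [bilinearForm, he.left]
  rw [e1] at h2 h3
  rw [e2] at h1 h3
  linarith

lemma IsFundamental.deriv_ode {b c d : ℝ} {g : ℝ → ℝ} (hg : IsFundamental b c d g) (z : ℝ) :
    deriv (deriv (deriv g)) z = b * deriv (deriv g) z + c * deriv g z := by
  have h1 : deriv (deriv g) = fun z => b * deriv g z + c * g z := funext hg.ode
  have d0 : Differentiable ℝ g := (hg.smooth 1).differentiable (by simp)
  have d1 : Differentiable ℝ (deriv g) :=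
    (contDiff_deriv_of_succ (n := 1) (hg.smooth 2)).differentiable (by simp)
  conv_lhs => rw [h1]
  exact (((d1 z).hasDerivAt.const_mul b).add ((d0 z).hasDerivAt.const_mul c)).deriv

/-- Stability of the boundary value problem. -/
lemma IsCollocationError.stability {n : ℕ} {b c d κ K M : ℝ} {N : ℕ} {x : ℕ → ℝ}
    {e : ℕ → ℝ → ℝ} {g : ℝ → ℝ} (he : IsCollocationError n b c N x M e)
    (hg : IsFundamental b c d g) (hd : x N - x 0 = d) (hN : 1 ≤ N) (hκ : 0 ≤ κ)
    (hK : ∀ z ∈ Set.Icc 0 d, |g z| ≤ K) (hK' : ∀ z ∈ Set.Icc 0 d, |deriv g z| ≤ K)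
    (hend : HasSmallMoments b c κ x e g N (x N)) {j : ℕ} {y : ℝ} (hj : j ∈ Finset.Icc 1 N)
    (hy0 : x 0 ≤ y) (hy1 : y ≤ x N)
    (hm : HasSmallMoments b c κ x e g j y) (hm' : HasSmallMoments b c κ x e (deriv g) j y) :
    |e j y| ≤ κ * (d * (1 + K / |g d|)) ∧ |deriv (e j) y| ≤ κ * (d * (1 + K / |g d|)) := by
  have hg2 : ContDiff ℝ 2 g := hg.smooth 2
  have hg2' : ContDiff ℝ 2 (deriv g) := contDiff_deriv_of_succ (n := 2) (hg.smooth 3)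
  have hgd : 0 < |g d| := abs_pos.2 hg.ne_zero
  have h1 := hend.duhamel he hg2 hg.ode (Finset.mem_Icc.2 ⟨hN, le_rfl⟩)
  have h2 := hm.duhamel he hg2 hg.ode hj
  have h3 := hm'.duhamel he hg2' hg.deriv_ode hj
  have h4 := hg.ode 0
  rw [hg.zero, hg.one] at h4
  rw [hg.zero, hg.one, he.right, hd, zero_mul, mul_zero, zero_add, zero_sub, abs_neg, abs_mul] at h1
  rw [hg.zero, hg.one] at h2
  rw [hg.one, h4] at h3
  ring_nf at h2 h3
  have hslope : |deriv (e 1) (x 0)| ≤ κ * d / |g d| := by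
    rw [le_div_iff₀ hgd]; linarith
  have hz : y - x 0 ∈ Set.Icc 0 d := ⟨by linarith, by linarith⟩
  have hK0 : 0 ≤ K := (abs_nonneg _).trans (hK _ hz)
  have hyd : κ * (y - x 0) ≤ κ * d := mul_le_mul_of_nonneg_left hz.2 hκ
  have fin : ∀ w v : ℝ, |w - v * deriv (e 1) (x 0)| ≤ κ * (y - x 0) → |v| ≤ K →
      |w| ≤ κ * (d * (1 + K / |g d|)) := by
    intro w v hw hv
    have t1 := abs_add_le (w - v * deriv (e 1) (x 0)) (v * deriv (e 1) (x 0))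
    rw [sub_add_cancel, abs_mul] at t1
    have t2 : |v| * |deriv (e 1) (x 0)| ≤ K * (κ * d / |g d|) := by gcongr
    have t3 : κ * (d * (1 + K / |g d|)) = κ * d + K * (κ * d / |g d|) := by ring
    linarith
  refine ⟨fin _ (g (y - x 0)) ?_ (hK _ hz), fin _ (deriv g (y - x 0)) ?_ (hK' _ hz)⟩
  · refine le_trans (le_of_eq ?_) (h2.trans (le_of_eq ?_))
    · congr 1
    · ring
  · refine le_trans (le_of_eq ?_) (h3.trans (le_of_eq ?_))
    · congr 1; ring_nf
    · ring

/-- A bounded residual has small moments. -/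
lemma hasSmallMoments_of_abs_odeResidual_le {b c d ρ K a₀ b₀ : ℝ} {N : ℕ} {x : ℕ → ℝ}
    {e : ℕ → ℝ → ℝ} {G : ℝ → ℝ} (hx : IsMesh a₀ b₀ N x)
    (hd : x N - x 0 = d) (hK : ∀ z ∈ Set.Icc 0 d, |G z| ≤ K)
    (hρ : ∀ i ∈ Finset.Icc 1 N, ∀ t ∈ Set.Icc (x (i - 1)) (x i), |odeResidual b c (e i) t| ≤ ρ)
    {j : ℕ} {y : ℝ} (hj : j ∈ Finset.Icc 1 N) (hy : y ∈ Set.Icc (x (j - 1)) (x j)) :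
    HasSmallMoments b c (K * ρ) x e G j y := by
  rw [Finset.mem_Icc] at hj
  have hd0 : 0 ≤ d := by rw [← hd]; linarith [hx.le (Nat.zero_le N) le_rfl]
  have hK0 : 0 ≤ K := (abs_nonneg _).trans (hK 0 ⟨le_rfl, hd0⟩)
  have main : ∀ i, 1 ≤ i → i ≤ N → ∀ z, x (i - 1) ≤ z → z ≤ x i → z ≤ y →
      |∫ t in x (i - 1)..z, G (y - t) * odeResidual b c (e i) t| ≤ K * ρ * (z - x (i - 1)) := by
    intro i hi hi' z hz0 hz1 hzy
    have := intervalIntegral.norm_integral_le_of_norm_le_const (a := x (i - 1)) (b := z)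
      (f := fun t => G (y - t) * odeResidual b c (e i) t) (C := K * ρ) (fun t ht => by
        rw [Set.uIoc_of_le hz0] at ht
        rw [Real.norm_eq_abs, abs_mul]
        have b1 := hK (y - t) ⟨by linarith [ht.2], by
          have h1 := hx.le (Nat.zero_le (i - 1)) (by omega)
          have h2 := hx.le hj.2 le_rfl
          linarith [ht.1, hy.2]⟩
        have b2 := hρ i (Finset.mem_Icc.2 ⟨hi, hi'⟩) t ⟨ht.1.le, ht.2.trans hz1⟩
        exact mul_le_mul b1 b2 (abs_nonneg _) hK0)
    rwa [abs_of_nonneg (by linarith : 0 ≤ z - x (i - 1)), Real.norm_eq_abs] at this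
  refine ⟨fun i hi hij => ?_, main j hj.1 hj.2 y hy.1 hy.2 le_rfl⟩
  exact main i hi (by omega) (x i) (hx.le (Nat.sub_le i 1) (by omega)) le_rfl
    ((hx.le (by omega) (by omega)).trans hy.1)

lemma IsCollocationError.exists_max_odeResidual {n : ℕ} {b c M a₀ b₀ : ℝ} {N : ℕ} {x : ℕ → ℝ}
    {e : ℕ → ℝ → ℝ} (he : IsCollocationError n b c N x M e) (hx : IsMesh a₀ b₀ N x) :
    ∃ i₀ ∈ Finset.Icc 1 N, ∃ t₀ ∈ Set.Icc (x (i₀ - 1)) (x i₀),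
      ∀ i ∈ Finset.Icc 1 N, ∀ t ∈ Set.Icc (x (i - 1)) (x i),
        |odeResidual b c (e i) t| ≤ |odeResidual b c (e i₀) t₀| := by
  have h1 : ∀ i, ∃ s, i ∈ Finset.Icc 1 N → s ∈ Set.Icc (x (i - 1)) (x i) ∧
      ∀ t ∈ Set.Icc (x (i - 1)) (x i), |odeResidual b c (e i) t| ≤ |odeResidual b c (e i) s| := by
    intro i
    by_cases hi : i ∈ Finset.Icc 1 N
    · have hc : Continuous (odeResidual b c (e i)) :=
        (contDiff_odeResidual (he.smooth i hi)).continuous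
      obtain ⟨s, hs, hs'⟩ := isCompact_Icc.exists_isMaxOn
        (Set.nonempty_Icc.2 (hx.lt hi).le) hc.abs.continuousOn
      exact ⟨s, fun _ => ⟨hs, fun t ht => hs' ht⟩⟩
    · exact ⟨0, fun h => absurd h hi⟩
  choose s hs using h1
  obtain ⟨i₀, hi₀, hmax⟩ := Finset.exists_max_image (Finset.Icc 1 N)
    (fun i => |odeResidual b c (e i) (s i)|) ⟨1, Finset.mem_Icc.2 ⟨le_rfl, hx.1⟩⟩
  exact ⟨i₀, hi₀, s i₀, (hs i₀ hi₀).1, fun i hi t ht => ((hs i hi).2 t ht).trans (hmax i hi)⟩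

lemma IsFundamental.exists_bound {b c d : ℝ} {g : ℝ → ℝ} (hg : IsFundamental b c d g) (m : ℕ) :
    ∃ K, 0 ≤ K ∧ ∀ j ≤ m, ∀ z ∈ Set.Icc 0 d, |iteratedDeriv j g z| ≤ K := by
  have h1 : ∀ j, ∃ K, ∀ z ∈ Set.Icc 0 d, |iteratedDeriv j g z| ≤ K := fun j => by
    have hc : Continuous (iteratedDeriv j g) := (hg.smooth j).continuous_iteratedDeriv j le_rfl
    simpa only [Real.norm_eq_abs] using
      isCompact_Icc.exists_bound_of_continuousOn (s := Set.Icc 0 d) hc.continuousOn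
  choose K hK using h1
  refine ⟨∑ j ∈ Finset.range (m + 1), |K j|, Finset.sum_nonneg fun _ _ => abs_nonneg _,
    fun j hj z hz => ((hK j z hz).trans (le_abs_self _)).trans ?_⟩
  exact Finset.single_le_sum (f := fun j => |K j|) (fun _ _ => abs_nonneg _)
    (Finset.mem_range.2 (by omega))

/-- Optimal order a priori estimate for the error, up to the second derivative. -/
lemma IsCollocationError.exists_apriori {n : ℕ} (hn : 2 ≤ n) {b c d : ℝ} (hc : 0 ≤ c)
    (hd : 0 < d) :
    ∃ C, 0 ≤ C ∧ ∃ h₀, 0 < h₀ ∧ h₀ ≤ 1 ∧ ∀ {N : ℕ} {x : ℕ → ℝ} {M h a₀ b₀ : ℝ} {e : ℕ → ℝ → ℝ},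
      IsCollocationError n b c N x M e → IsMesh a₀ b₀ N x → x N - x 0 = d → 0 ≤ M → h ≤ h₀ →
      (∀ i ∈ Finset.Icc 1 N, x i - x (i - 1) ≤ h) →
      ∀ i ∈ Finset.Icc 1 N, ∀ t ∈ Set.Icc (x (i - 1)) (x i), ∀ j ≤ 2,
        |iteratedDeriv j (e i) t| ≤ C * (M * h ^ n) := by
  obtain ⟨g, hg⟩ := exists_isFundamental (b := b) hc hd
  obtain ⟨K, hK0, hK⟩ := hg.exists_bound 1
  obtain ⟨C₁, hC₁, hres⟩ := exists_abs_odeResidual_le n hn b c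
  have hKg : ∀ z ∈ Set.Icc 0 d, |g z| ≤ K := fun z hz => by simpa using hK 0 (by omega) z hz
  have hKg' : ∀ z ∈ Set.Icc 0 d, |deriv g z| ≤ K := fun z hz => by
    simpa [iteratedDeriv_one] using hK 1 le_rfl z hz
  set A : ℝ := K * (d * (1 + K / |g d|)) with hA
  have hA0 : 0 ≤ A := by positivity
  set B : ℝ := 1 + (|b| + |c|) * A with hB
  have hB0 : 0 ≤ B := by positivity
  refine ⟨(A + B) * (2 * C₁), by positivity, min 1 (1 / (2 * C₁ * B + 1)), by positivity,
    min_le_left _ _, ?_⟩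
  intro N x M h a₀ b₀ e he hx hxd hM hh hmesh
  obtain ⟨i₀, hi₀, t₀, ht₀, hmax⟩ := he.exists_max_odeResidual hx
  set ρ := |odeResidual b c (e i₀) t₀| with hρ
  have hρ0 : 0 ≤ ρ := abs_nonneg _
  have hlow : ∀ i ∈ Finset.Icc 1 N, ∀ t ∈ Set.Icc (x (i - 1)) (x i),
      |e i t| ≤ A * ρ ∧ |deriv (e i) t| ≤ A * ρ := by
    intro i hi t ht
    have hi' := Finset.mem_Icc.1 hi
    have hN : N ∈ Finset.Icc 1 N := Finset.mem_Icc.2 ⟨hx.1, le_rfl⟩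
    have := he.stability hg hxd hx.1 (mul_nonneg hK0 hρ0) hKg hKg'
      (hasSmallMoments_of_abs_odeResidual_le hx hxd hKg hmax hN ⟨(hx.lt hN).le, le_rfl⟩) hi
      ((hx.le (Nat.zero_le (i - 1)) (by omega)).trans ht.1) (ht.2.trans (hx.le hi'.2 le_rfl))
      (hasSmallMoments_of_abs_odeResidual_le hx hxd hKg hmax hi ht)
      (hasSmallMoments_of_abs_odeResidual_le hx hxd hKg' hmax hi ht)
    rwa [show K * ρ * (d * (1 + K / |g d|)) = A * ρ by rw [hA]; ring] at this
  have hsecond : ∀ i ∈ Finset.Icc 1 N, ∀ t ∈ Set.Icc (x (i - 1)) (x i),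
      |iteratedDeriv 2 (e i) t| ≤ B * ρ := by
    intro i hi t ht
    have h1 : iteratedDeriv 2 (e i) t =
        odeResidual b c (e i) t + (b * deriv (e i) t + c * e i t) := by
      rw [iteratedDeriv_succ, iteratedDeriv_one, odeResidual]; ring
    have h2 : |b * deriv (e i) t + c * e i t| ≤ |b| * (A * ρ) + |c| * (A * ρ) := by
      refine (abs_add_le _ _).trans ?_
      rw [abs_mul, abs_mul]
      have := hlow i hi t ht
      gcongr
      exacts [this.2, this.1]
    rw [h1]
    refine (abs_add_le _ _).trans ?_
    have h3 := hmax i hi t ht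
    have h4 : B * ρ = ρ + (|b| * (A * ρ) + |c| * (A * ρ)) := by rw [hB]; ring
    linarith
  have hi₀' := Finset.mem_Icc.1 hi₀
  have hδ0 := hx.lt hi₀
  have hδ := hmesh i₀ hi₀
  have hh0 : 0 < h := by linarith
  have hres₀ : ρ ≤ C₁ * (M * (x i₀ - x (i₀ - 1)) ^ n + (x i₀ - x (i₀ - 1)) * (B * ρ)) :=
    hres ((he.smooth i₀ hi₀).of_le (by exact_mod_cast (by omega : n + 2 ≤ 2 * n + 2))) hδ0
      (hδ.trans (hh.trans (min_le_left _ _))) (hsecond i₀ hi₀)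
      (he.high i₀ hi₀ (n + 2) le_rfl (by omega)) (he.gauss i₀ hi₀) t₀ ht₀
  have hρle : ρ ≤ 2 * C₁ * (M * h ^ n) := by
    have h1 : ρ ≤ C₁ * (M * h ^ n + h * (B * ρ)) := by
      refine hres₀.trans ?_
      have : 0 ≤ x i₀ - x (i₀ - 1) := by linarith
      gcongr
    have h2 : h * (2 * C₁ * B + 1) ≤ 1 := by
      have := hh.trans (min_le_right _ _)
      rwa [le_div_iff₀ (by positivity)] at this
    have h3 : 2 * C₁ * B * h * ρ ≤ 1 * ρ := mul_le_mul_of_nonneg_right (by nlinarith) hρ0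
    nlinarith
  intro i hi t ht j hj
  have hAρ : A * ρ ≤ (A + B) * (2 * C₁) * (M * h ^ n) := by
    rw [mul_assoc (A + B)]; exact mul_le_mul (by linarith) (by linarith) hρ0 (by positivity)
  have hBρ : B * ρ ≤ (A + B) * (2 * C₁) * (M * h ^ n) := by
    rw [mul_assoc (A + B)]; exact mul_le_mul (by linarith) (by linarith) hρ0 (by positivity)
  interval_cases j
  · rw [iteratedDeriv_zero]; exact (hlow i hi t ht).1.trans hAρ
  · rw [iteratedDeriv_one]; exact (hlow i hi t ht).2.trans hAρ
  · exact (hsecond i hi t ht).trans hBρ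

/-- On quasi-uniform meshes all derivatives of the error are bounded. -/
lemma IsCollocationError.exists_abs_iteratedDeriv_le {n : ℕ} (hn : 2 ≤ n) {b c d c₀ : ℝ}
    (hc : 0 ≤ c) (hd : 0 < d) (hc₀ : 0 ≤ c₀) :
    ∃ C, 0 ≤ C ∧ ∃ h₀, 0 < h₀ ∧ h₀ ≤ 1 ∧ ∀ {N : ℕ} {x : ℕ → ℝ} {M h a₀ b₀ : ℝ} {e : ℕ → ℝ → ℝ},
      IsCollocationError n b c N x M e → IsMesh a₀ b₀ N x → x N - x 0 = d → 0 ≤ M → h ≤ h₀ →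
      (∀ i ∈ Finset.Icc 1 N, x i - x (i - 1) ≤ h) → IsQuasiUniform N x h c₀ →
      ∀ i ∈ Finset.Icc 1 N, ∀ j ≤ 2 * n + 2, ∀ t ∈ Set.Icc (x (i - 1)) (x i),
        |iteratedDeriv j (e i) t| ≤ C * M := by
  obtain ⟨C, hC, h₀, hh₀, hh₁, hap⟩ := IsCollocationError.exists_apriori hn (b := b) hc hd
  obtain ⟨L, hL, hint⟩ := exists_abs_iteratedDeriv_le_interpolation n
  refine ⟨C + (L * (C * c₀ ^ n) + 1), by positivity, h₀, hh₀, hh₁, ?_⟩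
  intro N x M h a₀ b₀ e he hx hxd hM hh hmesh hq i hi j hj t ht
  have hlow := hap he hx hxd hM hh hmesh i hi
  have hδ := hx.lt hi
  set δ := x i - x (i - 1) with hδdef
  have hδ0 : 0 < δ := by linarith
  have hh0 : 0 < h := hδ0.trans_le (hmesh i hi)
  have hδ1 : δ ≤ 1 := (hmesh i hi).trans (hh.trans hh₁)
  have hLC : 0 ≤ L * (C * c₀ ^ n) := by positivity
  rcases le_total j 2 with hj2 | hj2
  · refine (hlow t ht j hj2).trans ?_
    have : h ^ n ≤ 1 := pow_le_one₀ hh0.le (hh.trans hh₁)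
    calc C * (M * h ^ n) ≤ C * (M * 1) := by gcongr
      _ ≤ (C + (L * (C * c₀ ^ n) + 1)) * M := by nlinarith
  rcases le_total (n + 2) j with hjn | hjn
  · refine (he.high i hi j hjn hj t ht).trans ?_
    nlinarith
  obtain ⟨l, rfl⟩ : ∃ l, j = l + 2 := ⟨j - 2, by omega⟩
  have hit : ∀ m, iteratedDeriv m (iteratedDeriv 2 (e i)) = iteratedDeriv (m + 2) (e i) :=
    fun m => by simp only [iteratedDeriv_eq_iterate, ← Function.iterate_add_apply]
  have hsm : ContDiff ℝ n (iteratedDeriv 2 (e i)) := by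
    rw [iteratedDeriv_succ, iteratedDeriv_one]
    exact contDiff_deriv_of_succ (contDiff_deriv_of_succ ((he.smooth i hi).of_le
      (by exact_mod_cast (by omega : n + 1 + 1 ≤ 2 * n + 2))))
  have h1 := hint hsm hδ (fun t ht => hlow t ht 2 le_rfl)
    (fun t ht => by rw [hit]; exact he.high i hi (n + 2) le_rfl (by omega) t ht) l (by omega) t ht
  rw [hit, ← hδdef] at h1
  have h2 : h ^ n ≤ c₀ ^ n * δ ^ n := by
    rw [← mul_pow]; exact pow_le_pow_left₀ hh0.le (hq i hi) n
  have h3 : δ ^ n ≤ δ ^ l := pow_le_pow_of_le_one hδ0.le hδ1 (by omega)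
  have h4 : |iteratedDeriv (l + 2) (e i) t| * δ ^ l ≤ (L * (C * c₀ ^ n) + 1) * M * δ ^ l := by
    calc _ ≤ L * (C * (M * h ^ n)) + M * δ ^ n := h1
      _ ≤ L * (C * (M * (c₀ ^ n * δ ^ n))) + M * δ ^ n := by gcongr
      _ = (L * (C * c₀ ^ n) + 1) * M * δ ^ n := by ring
      _ ≤ _ := by gcongr
  have h5 := le_of_mul_le_mul_right h4 (by positivity)
  nlinarith

/-- Superconvergence at the mesh nodes for a collocation error. -/
lemma IsCollocationError.exists_superconvergence {n : ℕ} (hn : 2 ≤ n) {b c d c₀ : ℝ}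
    (hc : 0 ≤ c) (hd : 0 < d) (hc₀ : 0 ≤ c₀) :
    ∃ C, 0 ≤ C ∧ ∃ h₀, 0 < h₀ ∧ ∀ {N : ℕ} {x : ℕ → ℝ} {M h a₀ b₀ : ℝ} {e : ℕ → ℝ → ℝ},
      IsCollocationError n b c N x M e → IsMesh a₀ b₀ N x → x N - x 0 = d → 0 ≤ M → h ≤ h₀ →
      (∀ i ∈ Finset.Icc 1 N, x i - x (i - 1) ≤ h) → IsQuasiUniform N x h c₀ →
      ∀ i ∈ Finset.Icc 1 N, ∀ y, y = x (i - 1) ∨ y = x i →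
        |e i y| ≤ C * h ^ (2 * n) * M ∧ |deriv (e i) y| ≤ C * h ^ (2 * n) * M := by
  obtain ⟨g, hg⟩ := exists_isFundamental (b := b) hc hd
  obtain ⟨K, hK0, hK⟩ := hg.exists_bound (2 * n + 1)
  obtain ⟨C, hC, h₀, hh₀, -, hder⟩ :=
    IsCollocationError.exists_abs_iteratedDeriv_le hn (b := b) hc hd hc₀
  have hK1 : ∀ j ≤ 2 * n, ∀ z ∈ Set.Icc 0 d, |iteratedDeriv j g z| ≤ K :=
    fun j hj => hK j (by omega)
  have hK2 : ∀ j ≤ 2 * n, ∀ z ∈ Set.Icc 0 d, |iteratedDeriv j (deriv g) z| ≤ K :=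
    fun j hj => by rw [← iteratedDeriv_succ']; exact hK (j + 1) (by omega)
  have hgs : ContDiff ℝ (2 * n : ℕ) g := hg.smooth _
  have hgs' : ContDiff ℝ (2 * n : ℕ) (deriv g) := contDiff_deriv_of_succ (hg.smooth (2 * n + 1))
  set S : ℝ := (1 + |b| + |c|) * C with hS
  refine ⟨2 ^ (2 * n) * K * S * (d * (1 + K / |g d|)), by positivity, h₀, hh₀, ?_⟩
  intro N x M h a₀ b₀ e he hx hxd hM hh hmesh hq
  have hbd := hder he hx hxd hM hh hmesh hq
  have hh0 : 0 ≤ h := by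
    have h1 : 1 ∈ Finset.Icc 1 N := Finset.mem_Icc.2 ⟨le_rfl, hx.1⟩
    linarith [hx.lt h1, hmesh 1 h1]
  have hres : ∀ i ∈ Finset.Icc 1 N, ∀ j ≤ 2 * n, ∀ t ∈ Set.Icc (x (i - 1)) (x i),
      |iteratedDeriv j (odeResidual b c (e i)) t| ≤ S * M := by
    intro i hi j hj t ht
    rw [iteratedDeriv_odeResidual ((he.smooth i hi).of_le
      (by exact_mod_cast (by omega : j + 2 ≤ 2 * n + 2)))]
    refine (abs_sub _ _).trans ((add_le_add_left (abs_sub _ _) _).trans ?_)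
    rw [abs_mul, abs_mul]
    have h0 := hbd i hi j (by omega) t ht
    have h1 := hbd i hi (j + 1) (by omega) t ht
    have h2 := hbd i hi (j + 2) (by omega) t ht
    calc _ ≤ C * M + |b| * (C * M) + |c| * (C * M) := by gcongr
      _ = S * M := by rw [hS]; ring
  set κ : ℝ := h ^ (2 * n) * (2 ^ (2 * n) * K * (S * M)) with hκ
  have hSM : 0 ≤ S * M := by positivity
  have hκ0 : 0 ≤ κ := by positivity
  have hel : ∀ {G : ℝ → ℝ}, ContDiff ℝ (2 * n : ℕ) G →
      (∀ j ≤ 2 * n, ∀ z ∈ Set.Icc 0 d, |iteratedDeriv j G z| ≤ K) →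
      ∀ i ∈ Finset.Icc 1 N, ∀ y, x i ≤ y → y ≤ x N →
      |∫ t in x (i - 1)..x i, G (y - t) * odeResidual b c (e i) t| ≤ κ * (x i - x (i - 1)) := by
    intro G hG hGK i hi y hy hyN
    have hi' := Finset.mem_Icc.1 hi
    have hδ := hx.lt hi
    refine (abs_integral_mul_odeResidual_le hG (he.smooth i hi) hGK (hres i hi) hδ hy
      (by linarith [hx.le (Nat.zero_le (i - 1)) (by omega)]) (he.gauss i hi)).trans ?_
    have h1 : 0 ≤ x i - x (i - 1) := by linarith
    have h2 := hmesh i hi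
    rw [hκ]
    gcongr
  have hmom : ∀ {G : ℝ → ℝ}, ContDiff ℝ (2 * n : ℕ) G →
      (∀ j ≤ 2 * n, ∀ z ∈ Set.Icc 0 d, |iteratedDeriv j G z| ≤ K) →
      ∀ i ∈ Finset.Icc 1 N, ∀ y, y = x (i - 1) ∨ y = x i → HasSmallMoments b c κ x e G i y := by
    intro G hG hGK i hi y hy
    have hi' := Finset.mem_Icc.1 hi
    have hyl : x (i - 1) ≤ y := by rcases hy with rfl | rfl; exacts [le_rfl, (hx.lt hi).le]
    have hyr : y ≤ x N := by
      rcases hy with rfl | rfl <;> exact hx.le (by omega) le_rfl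
    refine ⟨fun j hj hji => hel hG hGK j (Finset.mem_Icc.2 ⟨hj, by omega⟩) y
      ((hx.le (by omega) (by omega)).trans hyl) hyr, ?_⟩
    rcases hy with rfl | rfl
    · simp
    · exact hel hG hGK i hi _ le_rfl hyr
  intro i hi y hy
  have hi' := Finset.mem_Icc.1 hi
  have hst := he.stability hg hxd hx.1 hκ0 (fun z hz => by simpa using hK1 0 (by omega) z hz)
    (fun z hz => by simpa using hK2 0 (by omega) z hz)
    (hmom hgs hK1 N (Finset.mem_Icc.2 ⟨hx.1, le_rfl⟩) (x N) (Or.inr rfl)) hi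
    (by rcases hy with rfl | rfl <;> exact hx.le (Nat.zero_le _) (by omega))
    (by rcases hy with rfl | rfl <;> exact hx.le (by omega) le_rfl)
    (hmom hgs hK1 i hi y hy) (hmom hgs' hK2 i hi y hy)
  rwa [show κ * (d * (1 + K / |g d|)) =
    2 ^ (2 * n) * K * S * (d * (1 + K / |g d|)) * h ^ (2 * n) * M by rw [hκ]; ring] at hst

/-- The error of the Gauss collocation solution is a collocation error. -/
lemma IsGaussSol.isCollocationError {n N : ℕ} {α β γ a b M : ℝ} {x : ℕ → ℝ} {u : ℝ → ℝ}
    {P : ℕ → Polynomial ℝ} (hα : 0 < α) (hx : IsMesh a b N x)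
    (hu : ContDiff ℝ (2 * n + 2 : ℕ) u) (hua : u a = 0) (hub : u b = 0)
    (hP : IsGaussSol (n + 1) N x α β γ
      (fun t => -α * iteratedDeriv 2 u t + β * deriv u t + γ * u t) P)
    (hM : ∀ j ≤ 2 * n + 2, ∀ y ∈ Set.Icc a b, |iteratedDeriv j u y| ≤ M) :
    IsCollocationError n (β / α) (γ / α) N x M (fun i t => u t - (P i).eval t) := by
  have hPs : ∀ i (m : ℕ), ContDiff ℝ m fun t => (P i).eval t := fun i m => by
    simpa using (P i).contDiff_aeval (𝕜 := ℝ) m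
  have hud : Differentiable ℝ u := hu.differentiable (by simp)
  have hd1 : ∀ i, deriv (fun t => u t - (P i).eval t) =
      fun t => deriv u t - (Polynomial.derivative (P i)).eval t := fun i => by
    funext t
    exact ((hud t).hasDerivAt.sub ((P i).hasDerivAt t)).deriv
  have hud1 : Differentiable ℝ (deriv u) :=
    (contDiff_deriv_of_succ (n := 2 * n + 1) hu).differentiable (by simp)
  have hd2 : ∀ i, deriv (deriv (fun t => u t - (P i).eval t)) = fun t =>
      deriv (deriv u) t - (Polynomial.derivative (Polynomial.derivative (P i))).eval t := by
    intro i
    rw [hd1]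
    funext t
    exact ((hud1 t).hasDerivAt.sub ((Polynomial.derivative (P i)).hasDerivAt t)).deriv
  obtain ⟨⟨hdeg, hval, hder, hl, hr⟩, hcol⟩ := hP
  refine ⟨fun i _ => hu.sub (hPs i _), fun i hi => ?_, fun i hi => ?_, ?_, ?_, ?_, ?_⟩
  · simp only [hval i hi]
  · simp only [hd1, hder i hi]
  · simp only [hl, sub_zero]; rw [hx.2.1, hua]
  · simp only [hr, sub_zero]; rw [hx.2.2.1, hub]
  · intro i hi s hs hs0
    have h1 := hcol i hi s hs (by simpa using hs0)
    rw [iteratedDeriv_succ, iteratedDeriv_one] at h1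
    simp only [odeResidual, hd2]
    simp only [hd1]
    field_simp
    linarith
  · intro i hi j hj hj' t ht
    have hi' := Finset.mem_Icc.1 hi
    have h1 : iteratedDeriv j (fun t => (P i).eval t) t = 0 := by
      rw [iteratedDeriv_polynomial_eval, Polynomial.iterate_derivative_eq_zero
        ((hdeg i hi).trans_lt (by omega))]
      exact Polynomial.eval_zero
    have h2 := iteratedDeriv_fun_sub (n := j) (x := t)
      (hu.of_le (by exact_mod_cast hj')).contDiffAt (hPs i j).contDiffAt
    rw [h2, h1, sub_zero]
    refine hM j hj' t ⟨?_, ?_⟩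
    · rw [← hx.2.1]; exact (hx.le (Nat.zero_le _) (by omega)).trans ht.1
    · rw [← hx.2.2.1]; exact ht.2.trans (hx.le hi'.2 le_rfl)

lemma abs_le_on_Icc_of_Ioo {f : ℝ → ℝ} (hf : Continuous f) {a b M : ℝ} (hab : a < b)
    (h : ∀ y ∈ Set.Ioo a b, |f y| ≤ M) : ∀ y ∈ Set.Icc a b, |f y| ≤ M := by
  intro y hy
  rw [← closure_Ioo hab.ne] at hy
  exact closure_minimal h (isClosed_le hf.abs continuous_const) hy

/-- Superconvergence of the Gauss collocation solution at the mesh nodes: both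
`|(u - ū_h)(x_i)|` and `|(u - ū_h)'(x_i)|` are bounded by `C h^{2(k-1)} ‖u‖_{2k,∞}`
at every node `x_i`, `i = 0, …, N`. -/
theorem gauss_collocation_superconvergence_at_nodes (k : ℕ) (hk : 3 ≤ k)
    (α β γ c d : ℝ) (hα : 0 < α) (hγ : 0 ≤ γ) (hc : 1 ≤ c) (hd : 0 < d) :
    ∃ C > 0, ∃ h₀ > 0, ∀ (a b : ℝ), b - a = d →
      ∀ (N : ℕ) (x : ℕ → ℝ) (h : ℝ),
        IsMesh a b N x → IsMeshSize N x h → IsQuasiUniform N x h c → h ≤ h₀ →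
      ∀ u : ℝ → ℝ, ContDiff ℝ (2 * k) u → u a = 0 → u b = 0 →
      ∀ Pb : ℕ → Polynomial ℝ,
        IsGaussSol k N x α β γ (fun t => -α * iteratedDeriv 2 u t + β * deriv u t + γ * u t) Pb →
      ∀ M : ℝ, (∀ j ≤ 2 * k, ∀ y ∈ Set.Ioo a b, |iteratedDeriv j u y| ≤ M) →
        ∀ i ∈ Finset.Icc 1 N,
          |u (x (i - 1)) - (Pb i).eval (x (i - 1))| ≤ C * h ^ (2 * (k - 1)) * M ∧
          |u (x i) - (Pb i).eval (x i)| ≤ C * h ^ (2 * (k - 1)) * M ∧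
          |deriv u (x (i - 1)) - (Polynomial.derivative (Pb i)).eval (x (i - 1))|
            ≤ C * h ^ (2 * (k - 1)) * M ∧
          |deriv u (x i) - (Polynomial.derivative (Pb i)).eval (x i)|
            ≤ C * h ^ (2 * (k - 1)) * M := by
  obtain ⟨n, rfl⟩ : ∃ n, k = n + 1 := ⟨k - 1, by omega⟩
  obtain ⟨C, hC, h₀, hh₀, hmain⟩ := IsCollocationError.exists_superconvergence (n := n) (by omega)
    (b := β / α) (c := γ / α) (div_nonneg hγ hα.le) hd (zero_le_one.trans hc)
  refine ⟨C + 1, by positivity, h₀, hh₀, ?_⟩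
  intro a b hab N x h hx hsize hq hh u hu hua hub Pb hP M hM i hi
  have hu' : ContDiff ℝ (2 * n + 2 : ℕ) u := by
    convert hu using 1
    push_cast
    ring
  have hlt : a < b := by linarith
  have hM' : ∀ j ≤ 2 * n + 2, ∀ y ∈ Set.Icc a b, |iteratedDeriv j u y| ≤ M := fun j hj =>
    abs_le_on_Icc_of_Ioo (hu'.continuous_iteratedDeriv j (by exact_mod_cast hj)) hlt
      (hM j (by omega))
  have hM0 : 0 ≤ M := (abs_nonneg _).trans (hM' 0 (Nat.zero_le _) a ⟨le_rfl, hlt.le⟩)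
  have hnode := hmain (hP.isCollocationError hα hx hu' hua hub hM') hx
    (by rw [hx.2.1, hx.2.2.1, hab]) hM0 hh hsize.1 hq i hi
  have hh0 : 0 ≤ h := by linarith [hx.lt hi, hsize.1 i hi]
  have hle : C * h ^ (2 * n) * M ≤ (C + 1) * h ^ (2 * (n + 1 - 1)) * M := by
    rw [Nat.add_sub_cancel]
    gcongr
    linarith
  have hderiv : ∀ t, deriv (fun t => u t - (Pb i).eval t) t =
      deriv u t - (Polynomial.derivative (Pb i)).eval t := fun t =>
    ((hu'.differentiable (by simp) t).hasDerivAt.sub ((Pb i).hasDerivAt t)).deriv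
  simp only [hderiv] at hnode
  obtain ⟨h1, h2⟩ := hnode (x (i - 1)) (Or.inl rfl)
  obtain ⟨h3, h4⟩ := hnode (x i) (Or.inr rfl)
  exact ⟨h1.trans hle, h3.trans hle, h2.trans hle, h4.trans hle⟩
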